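/- arXiv:2512.14393 — 6 statements merged into one kernel-verified Lean document; each statement's English description precedes it below -/
import Mathlib

section
/- There exist constants C > 0 and M > 0 such that for all L > 0 and α > 0 with L·α ≥ M, the first min-max value Λ₁ := inf over nonzero u ∈ D of t_{L,α}(u)/∫_{−L}^{L}|u(x)|² dx, taken over D := {u ∈ C¹([−L,L]; ℂ) : u(−L) = u(L) = 0}, satisfies −α²/4 < Λ₁ ≤ −α²/4 + C·α²·e^{−Lα/2}. -/
open MeasureTheory

/-- The quadratic form of the one-dimensional Laplacian on `(-L, L)` with an attractive
δ-interaction of strength `α` at the origin: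
`t_{L,α}(u) = ∫_{-L}^{L} |u'(x)|² dx − α |u(0)|²`. -/
noncomputable def tForm (L α : ℝ) (u : ℝ → ℂ) : ℝ :=
  (∫ x in (-L)..L, ‖deriv u x‖ ^ 2) - α * ‖u 0‖ ^ 2

/-- The first min-max value of `t_{L,α}` with Dirichlet boundary conditions at `±L`:
the infimum of the Rayleigh quotient over nonzero `C¹` functions vanishing at `±L`. -/
noncomputable def lambda1Dirichlet (L α : ℝ) : ℝ :=
  sInf {r : ℝ | ∃ u : ℝ → ℂ, ContDiff ℝ 1 u ∧ u (-L) = 0 ∧ u L = 0 ∧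
    (∃ x ∈ Set.Icc (-L) L, u x ≠ 0) ∧
    r = tForm L α u / ∫ x in (-L)..L, ‖u x‖ ^ 2}

/-- A Riccati-type bound: completing the square in `‖u' + g u‖²` and integrating over `[a, b]`. -/
theorem mul_integral_norm_sq_le_of_riccati {a b m : ℝ} (hab : a ≤ b) {u : ℝ → ℂ}
    (hu : ContDiff ℝ 1 u) {g g' : ℝ → ℝ} (hg : ∀ x, HasDerivAt g (g' x) x)
    (hg' : Continuous g') (hm : ∀ x ∈ Set.Icc a b, m ≤ g' x - g x ^ 2) :
    m * ∫ x in a..b, ‖u x‖ ^ 2 ≤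
      (∫ x in a..b, ‖deriv u x‖ ^ 2) + (g b * ‖u b‖ ^ 2 - g a * ‖u a‖ ^ 2) := by
  have hgc : Continuous g := continuous_iff_continuousAt.2 fun x ↦ (hg x).continuousAt
  have huc : Continuous u := hu.continuous
  have hdc : Continuous (deriv u) := hu.continuous_deriv le_rfl
  have hd : ∀ x, HasDerivAt (fun y ↦ g y * ‖u y‖ ^ 2)
      (g' x * ‖u x‖ ^ 2 + g x * (2 * inner ℝ (u x) (deriv u x))) x := fun x ↦
    (hg x).mul ((hu.differentiable one_ne_zero x).hasDerivAt.norm_sq)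
  have hc : Continuous fun x ↦
      g' x * ‖u x‖ ^ 2 + g x * (2 * inner ℝ (u x) (deriv u x)) := by fun_prop
  rw [← intervalIntegral.integral_eq_sub_of_hasDerivAt (fun x _ ↦ hd x)
      (hc.intervalIntegrable a b),
    ← intervalIntegral.integral_add ((by fun_prop : Continuous _).intervalIntegrable a b)
      (hc.intervalIntegrable a b), ← intervalIntegral.integral_const_mul]
  refine intervalIntegral.integral_mono_on hab
    ((by fun_prop : Continuous _).intervalIntegrable a b)
    ((by fun_prop : Continuous _).intervalIntegrable a b) fun x hx ↦ ?_
  have h1 := norm_add_sq_real (deriv u x) (g x • u x)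
  rw [inner_smul_right, real_inner_comm, norm_smul, mul_pow, Real.norm_eq_abs, sq_abs] at h1
  nlinarith [sq_nonneg ‖deriv u x + g x • u x‖,
    mul_le_mul_of_nonneg_right (hm x hx) (sq_nonneg ‖u x‖)]

theorem integral_norm_sq_le_of_halfline {a b L α β ε : ℝ} (hab : a ≤ b) (hε : 0 < ε)
    (hεL : ε * (L * Real.exp (α * L)) ^ 2 ≤ 1 / 2) (hβ : β ^ 2 = α ^ 2)
    (hx : ∀ x ∈ Set.Icc a b, |x| ≤ L ∧ 0 ≤ β * x ∧ β * x ≤ α * L) {u : ℝ → ℂ}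
    (hu : ContDiff ℝ 1 u) :
    (-α ^ 2 / 4 + ε / 2) * ∫ x in a..b, ‖u x‖ ^ 2 ≤
      (∫ x in a..b, ‖deriv u x‖ ^ 2) +
        ((β / 2 + ε * (b * Real.exp (β * b))) * ‖u b‖ ^ 2 -
          (β / 2 + ε * (a * Real.exp (β * a))) * ‖u a‖ ^ 2) := by
  refine mul_integral_norm_sq_le_of_riccati hab hu
    (g := fun x ↦ β / 2 + ε * (x * Real.exp (β * x)))
    (g' := fun x ↦ ε * ((1 + β * x) * Real.exp (β * x))) (fun x ↦ ?_) (by fun_prop) fun x h ↦ ?_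
  · have h := (((hasDerivAt_id x).mul (((hasDerivAt_id x).const_mul β).exp)).const_mul
      ε).const_add (β / 2)
    refine h.congr_deriv ?_
    simp only [id]
    ring
  · obtain ⟨h1, h2, h3⟩ := hx x h
    have he : 1 ≤ Real.exp (β * x) := Real.one_le_exp h2
    have hE : |x| * Real.exp (β * x) ≤ L * Real.exp (α * L) := by
      have := (abs_nonneg x).trans h1
      gcongr
    have hsq : x ^ 2 * Real.exp (β * x) ^ 2 ≤ (L * Real.exp (α * L)) ^ 2 := by
      rw [← sq_abs x, ← mul_pow]
      gcongr
    have h4 : ε * (x ^ 2 * Real.exp (β * x) ^ 2) ≤ 1 / 2 :=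
      (mul_le_mul_of_nonneg_left hsq hε.le).trans hεL
    have h5 : 0 ≤ ε * (Real.exp (β * x) - ε * (x ^ 2 * Real.exp (β * x) ^ 2) - 1 / 2) :=
      mul_nonneg hε.le (by linarith)
    linarith

theorem exists_pos_mul_integral_norm_sq_le_tForm {L α : ℝ} (hL : 0 < L) (hα : 0 < α) :
    ∃ δ > (0 : ℝ), ∀ u : ℝ → ℂ, ContDiff ℝ 1 u → u (-L) = 0 → u L = 0 →
      (-α ^ 2 / 4 + δ) * ∫ x in (-L)..L, ‖u x‖ ^ 2 ≤ tForm L α u := by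
  have hE : 0 < L * Real.exp (α * L) := by positivity
  obtain ⟨ε, hε, hεL⟩ : ∃ ε > 0, ε * (L * Real.exp (α * L)) ^ 2 ≤ 1 / 2 :=
    ⟨1 / 2 / (L * Real.exp (α * L)) ^ 2, by positivity, by field_simp; exact le_rfl⟩
  refine ⟨ε / 2, by positivity, fun u hu hl hr ↦ ?_⟩
  have hright := integral_norm_sq_le_of_halfline (β := α) hL.le hε hεL rfl
    (fun x hx ↦ ⟨by rw [abs_of_nonneg hx.1]; exact hx.2, mul_nonneg hα.le hx.1,
      mul_le_mul_of_nonneg_left hx.2 hα.le⟩) hu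
  have hleft := integral_norm_sq_le_of_halfline (β := -α) (neg_nonpos.2 hL.le) hε hεL
    (neg_sq α) (fun x hx ↦ ⟨by rw [abs_of_nonpos hx.2]; linarith [hx.1],
      by nlinarith [hx.2], by nlinarith [hx.1]⟩) hu
  have huc : Continuous u := hu.continuous
  have hdc : Continuous (deriv u) := hu.continuous_deriv le_rfl
  have hn : Continuous fun x ↦ ‖u x‖ ^ 2 := by fun_prop
  have hdn : Continuous fun x ↦ ‖deriv u x‖ ^ 2 := by fun_prop
  rw [tForm, ← intervalIntegral.integral_add_adjacent_intervals
      (hn.intervalIntegrable (-L) 0) (hn.intervalIntegrable 0 L),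
    ← intervalIntegral.integral_add_adjacent_intervals
      (hdn.intervalIntegrable (-L) 0) (hdn.intervalIntegrable 0 L), mul_add]
  simp only [hl, hr, norm_zero] at hleft hright
  linarith

theorem integral_norm_sq_pos {L : ℝ} (hL : 0 < L) {u : ℝ → ℂ} (hu : Continuous u)
    (hne : ∃ x ∈ Set.Icc (-L) L, u x ≠ 0) : 0 < ∫ x in (-L)..L, ‖u x‖ ^ 2 := by
  obtain ⟨x, hx, hux⟩ := hne
  exact intervalIntegral.integral_pos (by linarith) (by fun_prop) (fun _ _ ↦ by positivity)
    ⟨x, hx, by positivity⟩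

theorem integral_exp_neg_mul_abs_le {L k : ℝ} (hL : 0 < L) (hk : 0 < k) :
    ∫ x in (-L)..L, Real.exp (-(k * |x|)) ≤ 2 / k := by
  have hc : Continuous fun x : ℝ ↦ Real.exp (-(k * |x|)) := by fun_prop
  have hr : ∫ x in (0 : ℝ)..L, Real.exp (-(k * |x|)) ≤ 1 / k := by
    have hd : ∀ x : ℝ, HasDerivAt (fun y ↦ -Real.exp (-(k * y)) / k) (Real.exp (-(k * x))) x := by
      intro x
      have h := (((hasDerivAt_id x).const_mul k).neg.exp.neg).div_const k
      refine h.congr_deriv ?_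
      simp only [id, Pi.neg_apply]
      field_simp
    rw [intervalIntegral.integral_congr (g := fun x ↦ Real.exp (-(k * x))) fun x hx ↦ by
        rw [Set.uIcc_of_le hL.le] at hx
        simp only [abs_of_nonneg hx.1],
      intervalIntegral.integral_eq_sub_of_hasDerivAt (fun x _ ↦ hd x)
        ((by fun_prop : Continuous _).intervalIntegrable 0 L), ← sub_div]
    gcongr
    simp [Real.exp_nonneg]
  have hl : ∫ x in (-L)..0, Real.exp (-(k * |x|)) = ∫ x in (0 : ℝ)..L, Real.exp (-(k * |x|)) := by
    simpa using intervalIntegral.integral_comp_neg (a := -L) (b := 0)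
      (fun x ↦ Real.exp (-(k * |x|)))
  rw [← intervalIntegral.integral_add_adjacent_intervals
    (hc.intervalIntegrable (-L) 0) (hc.intervalIntegrable 0 L), hl]
  calc _ ≤ 1 / k + 1 / k := add_le_add hr hr
    _ = 2 / k := by ring

theorem exists_trial_function {L α : ℝ} (hL : 0 < L) (hα : 0 < α) :
    ∃ u : ℝ → ℂ, ContDiff ℝ 1 u ∧ u (-L) = 0 ∧ u L = 0 ∧
      1 - 2 * Real.exp (-(L * α) / 2) ≤ ‖u 0‖ ∧
      (∫ x in (-L)..L, ‖u x‖ ^ 2) ≤ 2 / α ∧ (∫ x in (-L)..L, ‖deriv u x‖ ^ 2) ≤ α / 2 := by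
  set q := Real.exp (-(L * α) / 2) with hq
  have hq0 : 0 < q := Real.exp_pos _
  set ε := 2 * q / α with hεdef
  have hε : 0 < ε := by positivity
  set s : ℝ → ℝ := fun x ↦ √(x ^ 2 + ε ^ 2) with hs
  have hpos : ∀ x, 0 < x ^ 2 + ε ^ 2 := fun x ↦ by positivity
  have hspos : ∀ x, 0 < s x := fun x ↦ Real.sqrt_pos.2 (hpos x)
  have hsabs : ∀ x, |x| ≤ s x := fun x ↦ Real.abs_le_sqrt (by nlinarith)
  have hsd : ∀ x, HasDerivAt s (x / s x) x := fun x ↦ by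
    have h := ((hasDerivAt_pow 2 x).add_const (ε ^ 2)).sqrt (hpos x).ne'
    refine h.congr_deriv ?_
    simp only [hs]
    have := (hspos x).ne'
    push_cast
    rw [pow_one, mul_div_mul_left _ _ two_ne_zero]
  have hsC : ContDiff ℝ 1 s :=
    ((contDiff_id.pow 2).add contDiff_const).sqrt fun x ↦ (hpos x).ne'
  set w : ℝ → ℝ := fun x ↦ Real.exp (-(α / 2 * s x)) - Real.exp (-(α / 2 * s L)) with hw
  have hwC : ContDiff ℝ 1 w := ((contDiff_const.mul hsC).neg.exp).sub contDiff_const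
  have hwd : ∀ x, HasDerivAt (fun y ↦ (w y : ℂ))
      ((Real.exp (-(α / 2 * s x)) * -(α / 2 * (x / s x)) : ℝ) : ℂ) x := fun x ↦
    ((((hsd x).const_mul (α / 2)).neg.exp).sub_const _).ofReal_comp
  have huC : ContDiff ℝ 1 fun x ↦ (w x : ℂ) := Complex.ofRealCLM.contDiff.comp hwC
  have hexp : ∀ x, Real.exp (-(α / 2 * s x)) ^ 2 ≤ Real.exp (-(α * |x|)) := fun x ↦ by
    rw [← Real.exp_nat_mul, Real.exp_le_exp]
    push_cast
    nlinarith [hsabs x]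
  have hint := integral_exp_neg_mul_abs_le hL hα
  have hec : Continuous fun x : ℝ ↦ Real.exp (-(α * |x|)) := by fun_prop
  refine ⟨fun x ↦ (w x : ℂ), huC, by simp [hw, hs], by simp [hw], ?_, ?_, ?_⟩
  · have h0 : s 0 = ε := by simp [hs, Real.sqrt_sq hε.le]
    have h1 : α / 2 * ε = q := by rw [hεdef]; field_simp
    have h2 : Real.exp (-(α / 2 * s L)) ≤ q := by
      rw [hq, Real.exp_le_exp]
      nlinarith [hsabs L, le_abs_self L]
    rw [Complex.norm_real]
    refine le_trans ?_ (Real.le_norm_self _)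
    simp only [hw, h0, h1]
    linarith [Real.add_one_le_exp (-q)]
  · refine le_trans (intervalIntegral.integral_mono_on (by linarith)
      ((huC.continuous.norm.pow 2).intervalIntegrable _ _) (hec.intervalIntegrable _ _)
      fun x hx ↦ ?_) hint
    refine le_trans ?_ (hexp x)
    have hsle : s x ≤ s L := Real.sqrt_le_sqrt (by nlinarith [hx.1, hx.2])
    have hle : Real.exp (-(α / 2 * s L)) ≤ Real.exp (-(α / 2 * s x)) :=
      Real.exp_le_exp.2 (by nlinarith)
    rw [Complex.norm_real, Real.norm_of_nonneg (sub_nonneg.2 hle)]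
    have := sub_nonneg.2 hle
    gcongr
    exact sub_le_self _ (Real.exp_nonneg _)
  · have hdc : Continuous (deriv fun x ↦ (w x : ℂ)) := huC.continuous_deriv le_rfl
    calc (∫ x in (-L)..L, ‖deriv (fun x ↦ (w x : ℂ)) x‖ ^ 2)
        ≤ ∫ x in (-L)..L, (α / 2) ^ 2 * Real.exp (-(α * |x|)) := by
          refine intervalIntegral.integral_mono_on (by linarith)
            ((hdc.norm.pow 2).intervalIntegrable _ _)
            ((continuous_const.mul hec).intervalIntegrable _ _) fun x _ ↦ ?_
          have hx : (x / s x) ^ 2 ≤ 1 := by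
            rw [← sq_abs, abs_div, abs_of_pos (hspos x)]
            exact pow_le_one₀ (by have := hspos x; positivity)
              ((div_le_one (hspos x)).2 (hsabs x))
          rw [(hwd x).deriv, Complex.norm_real, Real.norm_eq_abs, sq_abs]
          calc (Real.exp (-(α / 2 * s x)) * -(α / 2 * (x / s x))) ^ 2
              = (α / 2) ^ 2 * (Real.exp (-(α / 2 * s x)) ^ 2 * (x / s x) ^ 2) := by ring
            _ ≤ (α / 2) ^ 2 * (Real.exp (-(α * |x|)) * 1) := by
                gcongr
                exact hexp x
            _ = _ := by ring
      _ ≤ (α / 2) ^ 2 * (2 / α) := by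
          rw [intervalIntegral.integral_const_mul]
          gcongr
      _ = α / 2 := by field_simp

theorem stmt5 : ∃ C > (0 : ℝ), ∃ M > (0 : ℝ), ∀ L α : ℝ, 0 < L → 0 < α → M ≤ L * α →
    -α ^ 2 / 4 < lambda1Dirichlet L α ∧
      lambda1Dirichlet L α ≤ -α ^ 2 / 4 + C * α ^ 2 * Real.exp (-(L * α) / 2) := by
  refine ⟨2, by norm_num, 14, by norm_num, fun L α hL hα hM ↦ ?_⟩
  obtain ⟨δ, hδ, hlow⟩ := exists_pos_mul_integral_norm_sq_le_tForm hL hα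
  obtain ⟨u, huC, hul, hur, hu0, hN, hT⟩ := exists_trial_function hL hα
  set q := Real.exp (-(L * α) / 2)
  have hq0 : 0 < q := Real.exp_pos _
  have hq : q ≤ 1 / 8 := by
    have h1 := Real.add_one_le_exp (L * α / 2)
    have h2 : q * Real.exp (L * α / 2) = 1 := by
      rw [← Real.exp_add]
      simp [neg_div]
    nlinarith
  have hne : ∃ x ∈ Set.Icc (-L) L, u x ≠ 0 :=
    ⟨0, ⟨by linarith, hL.le⟩, norm_pos_iff.1 (by linarith)⟩
  have hbound : ∀ r ∈ {r : ℝ | ∃ u : ℝ → ℂ, ContDiff ℝ 1 u ∧ u (-L) = 0 ∧ u L = 0 ∧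
      (∃ x ∈ Set.Icc (-L) L, u x ≠ 0) ∧
      r = tForm L α u / ∫ x in (-L)..L, ‖u x‖ ^ 2}, -α ^ 2 / 4 + δ ≤ r := by
    rintro r ⟨v, hv, hvl, hvr, hvne, rfl⟩
    exact (le_div_iff₀ (integral_norm_sq_pos hL hv.continuous hvne)).2 (hlow v hv hvl hvr)
  constructor
  · exact (lt_add_of_pos_right _ hδ).trans_le
      (le_csInf ⟨_, u, huC, hul, hur, hne, rfl⟩ hbound)
  · refine (csInf_le ⟨_, hbound⟩ ⟨u, huC, hul, hur, hne, rfl⟩).trans ?_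
    have hNpos := integral_norm_sq_pos hL huC.continuous hne
    have hsq : 1 - 4 * q ≤ ‖u 0‖ ^ 2 := by nlinarith
    have ht : tForm L α u ≤ -(α / 2 * (1 - 8 * q)) := by
      rw [tForm]
      nlinarith [mul_le_mul_of_nonneg_left hsq hα.le]
    rw [div_le_iff₀ hNpos]
    have h1 : 0 ≤ α ^ 2 / 4 * (1 - 8 * q) := mul_nonneg (by positivity) (by linarith)
    have h2 := mul_le_mul_of_nonneg_left hN h1
    have h3 : α ^ 2 / 4 * (1 - 8 * q) * (2 / α) = α / 2 * (1 - 8 * q) := by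
      field_simp
      ring
    linarith
end

section
/- There exist constants C > 0 and M > 0 such that for all L > 0 and α > 0 with L·α ≥ M, the first min-max value Λ₁ := inf over nonzero u ∈ C¹([−L,L]; ℂ) of t_{L,α}(u)/∫_{−L}^{L}|u(x)|² dx satisfies −α²/4 − C·α²·e^{−Lα/2} ≤ Λ₁ < −α²/4. -/
open MeasureTheory

/-- The first min-max value of `t_{L,α}` with Neumann boundary conditions (no boundary
condition imposed on trial functions): the infimum of the Rayleigh quotient over
nonzero `C¹` functions on `[-L, L]`. -/
noncomputable def lambda1Neumann (L α : ℝ) : ℝ :=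
  sInf {r : ℝ | ∃ u : ℝ → ℂ, ContDiff ℝ 1 u ∧
    (∃ x ∈ Set.Icc (-L) L, u x ≠ 0) ∧
    r = tForm L α u / ∫ x in (-L)..L, ‖u x‖ ^ 2}

lemma hasDerivAt_mul_sinh_div_cosh (κ L x : ℝ) :
    HasDerivAt (fun y => κ * (Real.sinh (κ * (L - y)) / Real.cosh (κ * (L - y))))
      ((κ * (Real.sinh (κ * (L - x)) / Real.cosh (κ * (L - x)))) ^ 2 - κ ^ 2) x := by
  have h : HasDerivAt (fun y => κ * (L - y)) (κ * (-1)) x :=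
    ((hasDerivAt_id x).const_sub L).const_mul κ
  have hc := (Real.cosh_pos (κ * (L - x))).ne'
  refine ((h.sinh.div h.cosh hc).const_mul κ).congr_deriv ?_
  field_simp
  ring

/-- A Riccati-type lower bound for the Dirichlet energy on a half interval. -/
lemma tanh_mul_norm_sq_le_integral {u : ℝ → ℂ} (hu : ContDiff ℝ 1 u) {L : ℝ} (hL : 0 ≤ L)
    (κ : ℝ) :
    κ * Real.tanh (κ * L) * ‖u 0‖ ^ 2 ≤
      (∫ x in (0)..L, ‖deriv u x‖ ^ 2) + κ ^ 2 * ∫ x in (0)..L, ‖u x‖ ^ 2 := by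
  set w : ℝ → ℝ := fun y => κ * (Real.sinh (κ * (L - y)) / Real.cosh (κ * (L - y))) with hw
  have hwd : ∀ x, HasDerivAt w (w x ^ 2 - κ ^ 2) x := hasDerivAt_mul_sinh_div_cosh κ L
  have hwc : Continuous w :=
    continuous_iff_continuousAt.2 fun x => (hwd x).continuousAt
  have huc : Continuous u := hu.continuous
  have hdc : Continuous (deriv u) := hu.continuous_deriv le_rfl
  have hud : ∀ x, HasDerivAt u (deriv u x) x := fun x =>
    (hu.differentiable one_ne_zero x).hasDerivAt
  set F' : ℝ → ℝ := fun x =>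
    (w x ^ 2 - κ ^ 2) * ‖u x‖ ^ 2 + w x * (2 * inner ℝ (u x) (deriv u x)) with hF'
  have hFd : ∀ x, HasDerivAt (fun y => w y * ‖u y‖ ^ 2) (F' x) x := fun x =>
    (hwd x).mul (hud x).norm_sq
  have hF'c : Continuous F' := by fun_prop
  have hftc := intervalIntegral.integral_eq_sub_of_hasDerivAt (a := 0) (b := L)
    (fun x _ => hFd x) (hF'c.intervalIntegrable _ _)
  have hwL : w L = 0 := by simp [hw]
  have hw0 : w 0 = κ * Real.tanh (κ * L) := by simp [hw, Real.tanh_eq_sinh_div_cosh]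
  have hpos : 0 ≤ ∫ x in (0)..L, (‖deriv u x‖ ^ 2 + κ ^ 2 * ‖u x‖ ^ 2 + F' x) := by
    refine intervalIntegral.integral_nonneg hL fun x _ => ?_
    have h := norm_add_sq_real (deriv u x) (w x • u x)
    rw [inner_smul_right, norm_smul, mul_pow, Real.norm_eq_abs, sq_abs,
      real_inner_comm] at h
    have h0 := sq_nonneg ‖deriv u x + w x • u x‖
    simp only [hF']
    nlinarith
  have i1 : IntervalIntegrable (fun x => ‖deriv u x‖ ^ 2) volume 0 L :=
    (hdc.norm.pow 2).intervalIntegrable _ _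
  have i2 : IntervalIntegrable (fun x => κ ^ 2 * ‖u x‖ ^ 2) volume 0 L :=
    (continuous_const.mul (huc.norm.pow 2)).intervalIntegrable _ _
  rw [intervalIntegral.integral_add (i1.add i2) (hF'c.intervalIntegrable _ _),
    intervalIntegral.integral_add i1 i2, intervalIntegral.integral_const_mul, hftc, hwL, hw0]
    at hpos
  linarith

lemma integral_neg_self_eq_add {f : ℝ → ℝ} (hf : Continuous f) (L : ℝ) :
    ∫ x in (-L)..L, f x = (∫ x in (0)..L, f x) + ∫ x in (0)..L, f (-x) := by
  rw [intervalIntegral.integral_comp_neg, neg_zero, add_comm]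
  exact (intervalIntegral.integral_add_adjacent_intervals (hf.intervalIntegrable _ _)
    (hf.intervalIntegrable _ _)).symm

lemma neg_sq_mul_integral_le_tForm {u : ℝ → ℂ} (hu : ContDiff ℝ 1 u) {L α κ : ℝ} (hL : 0 ≤ L)
    (hκ : α ≤ 2 * (κ * Real.tanh (κ * L))) :
    -κ ^ 2 * ∫ x in (-L)..L, ‖u x‖ ^ 2 ≤ tForm L α u := by
  have h1 := tanh_mul_norm_sq_le_integral hu hL κ
  have h2 := tanh_mul_norm_sq_le_integral (hu.comp contDiff_neg) hL κ
  have hd : ∀ x, deriv (u ∘ fun y : ℝ => -y) x = -deriv u (-x) := fun x => deriv_comp_neg u x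
  simp only [hd, norm_neg, Function.comp_apply, neg_zero] at h2
  have hdc : Continuous (deriv u) := hu.continuous_deriv le_rfl
  rw [tForm, integral_neg_self_eq_add (f := fun x => ‖deriv u x‖ ^ 2) (hdc.norm.pow 2),
    integral_neg_self_eq_add (f := fun x => ‖u x‖ ^ 2) (hu.continuous.norm.pow 2)]
  have h3 := mul_le_mul_of_nonneg_right hκ (sq_nonneg ‖u 0‖)
  linarith

lemma neg_sq_le_rayleigh {u : ℝ → ℂ} (hu : ContDiff ℝ 1 u) {L α κ : ℝ} (hL : 0 ≤ L)
    (hκ : α ≤ 2 * (κ * Real.tanh (κ * L))) :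
    -κ ^ 2 ≤ tForm L α u / ∫ x in (-L)..L, ‖u x‖ ^ 2 := by
  have hN : 0 ≤ ∫ x in (-L)..L, ‖u x‖ ^ 2 :=
    intervalIntegral.integral_nonneg (by linarith) fun x _ => sq_nonneg _
  rcases hN.eq_or_lt with h | h
  · rw [← h, div_zero]
    linarith [sq_nonneg κ]
  · rw [le_div_iff₀ h]
    exact neg_sq_mul_integral_le_tForm hu hL hκ

/-- A value of `κ` slightly above `α / 2` that satisfies the hypothesis of
`neg_sq_le_rayleigh`. -/
lemma exists_le_two_mul_tanh {L α : ℝ} (hL : 0 < L) (hα : 0 < α) (h : 1 ≤ L * α) :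
    ∃ κ : ℝ, α ≤ 2 * (κ * Real.tanh (κ * L)) ∧
      κ ^ 2 ≤ α ^ 2 / 4 + 4 * α ^ 2 * Real.exp (-(L * α) / 2) := by
  set q := Real.exp (-(L * α)) with hq
  have hq0 : 0 < q := Real.exp_pos _
  have hq1 : q ≤ 1 / 2 := by
    have h1 : q ≤ Real.exp (-1) := Real.exp_le_exp.2 (by linarith)
    linarith [Real.exp_neg_one_lt_half]
  have hqe : q ≤ Real.exp (-(L * α) / 2) := Real.exp_le_exp.2 (by linarith)
  have h1q : 0 < 1 - q := by linarith
  refine ⟨α / 2 * ((1 + q) / (1 - q)), ?_, ?_⟩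
  · set κ := α / 2 * ((1 + q) / (1 - q)) with hκ
    have hge : 1 ≤ (1 + q) / (1 - q) := by rw [le_div_iff₀ h1q]; linarith
    have hκα : α / 2 ≤ κ := by nlinarith
    have ht : (1 - q) / (1 + q) ≤ Real.tanh (κ * L) := by
      have hs : Real.exp (-(2 * (κ * L))) ≤ q :=
        Real.exp_le_exp.2 (by nlinarith)
      have hE := Real.exp_pos (-(2 * (κ * L)))
      have he : Real.tanh (κ * L) =
          (1 - Real.exp (-(2 * (κ * L)))) / (1 + Real.exp (-(2 * (κ * L)))) := by
        have hx : Real.exp (-(2 * (κ * L))) = Real.exp (-(κ * L)) * Real.exp (-(κ * L)) := by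
          rw [← Real.exp_add]; ring_nf
        have hx' : Real.exp (κ * L) * Real.exp (-(κ * L)) = 1 := by
          rw [← Real.exp_add]; simp
        have p1 := Real.exp_pos (κ * L)
        have p2 := Real.exp_pos (-(κ * L))
        rw [Real.tanh_eq, hx, div_eq_div_iff (by positivity) (by positivity)]
        linear_combination (2 * Real.exp (-(κ * L))) * hx'
      rw [he, div_le_div_iff₀ (by linarith) (by linarith)]
      nlinarith
    have hm : κ * ((1 - q) / (1 + q)) = α / 2 := by
      rw [hκ]
      field_simp
    have := mul_le_mul_of_nonneg_left ht (by linarith : (0 : ℝ) ≤ κ)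
    linarith
  · have hb : ((1 + q) / (1 - q)) ^ 2 ≤ 1 + 16 * q := by
      rw [div_pow, div_le_iff₀ (by positivity)]
      nlinarith [mul_nonneg hq0.le (by nlinarith : 0 ≤ 4 * (1 - q) ^ 2 - 1)]
    have hα2 : 0 < α ^ 2 := by positivity
    calc (α / 2 * ((1 + q) / (1 - q))) ^ 2 = α ^ 2 / 4 * ((1 + q) / (1 - q)) ^ 2 := by ring
      _ ≤ α ^ 2 / 4 * (1 + 16 * q) := by gcongr
      _ ≤ α ^ 2 / 4 + 4 * α ^ 2 * Real.exp (-(L * α) / 2) := by nlinarith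

/-- A smooth approximation of `exp (-α |x| / 2)`, normalised to be `1` at the origin. -/
noncomputable def smoothedExp (α ε x : ℝ) : ℝ :=
  Real.exp (-(α / 2) * (√(x ^ 2 + ε ^ 2) - ε))

lemma hasDerivAt_smoothedExp (α : ℝ) {ε : ℝ} (hε : 0 < ε) (x : ℝ) :
    HasDerivAt (smoothedExp α ε)
      (smoothedExp α ε x * (-(α / 2) * (x / √(x ^ 2 + ε ^ 2)))) x := by
  have hne : x ^ 2 + ε ^ 2 ≠ 0 := by positivity
  have h1 : HasDerivAt (fun y : ℝ => y ^ 2 + ε ^ 2) (2 * x) x := by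
    simpa using ((hasDerivAt_id x).pow 2).add_const (ε ^ 2)
  have h2 := (((h1.sqrt hne).sub_const ε).const_mul (-(α / 2))).exp
  refine h2.congr_deriv ?_
  simp only [smoothedExp]
  field_simp

lemma contDiff_smoothedExp (α : ℝ) {ε : ℝ} (hε : 0 < ε) :
    ContDiff ℝ 1 (smoothedExp α ε) := by
  have hne : ∀ x : ℝ, x ^ 2 + ε ^ 2 ≠ 0 := fun x => by positivity
  have h1 : ContDiff ℝ 1 fun x : ℝ => √(x ^ 2 + ε ^ 2) :=
    ((contDiff_id.pow 2).add contDiff_const).sqrt hne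
  exact (contDiff_const.mul (h1.sub contDiff_const)).exp

lemma smoothedExp_sq_le {α : ℝ} (hα : 0 < α) (ε x : ℝ) :
    smoothedExp α ε x ^ 2 ≤ Real.exp (α * ε) * Real.exp (-α * x) := by
  rw [smoothedExp, sq, ← Real.exp_add, ← Real.exp_add, Real.exp_le_exp]
  have : x ≤ √(x ^ 2 + ε ^ 2) := Real.le_sqrt_of_sq_le (by nlinarith [sq_nonneg ε])
  nlinarith

lemma deriv_smoothedExp_sq_le (α : ℝ) {ε : ℝ} (hε : 0 < ε) (x : ℝ) :
    deriv (smoothedExp α ε) x ^ 2 ≤ α ^ 2 / 4 * smoothedExp α ε x ^ 2 := by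
  rw [(hasDerivAt_smoothedExp α hε x).deriv]
  have h : (x / √(x ^ 2 + ε ^ 2)) ^ 2 ≤ 1 := by
    rw [div_pow, Real.sq_sqrt (by positivity), div_le_one (by positivity)]
    nlinarith [sq_nonneg ε]
  calc (smoothedExp α ε x * (-(α / 2) * (x / √(x ^ 2 + ε ^ 2)))) ^ 2
      = α ^ 2 / 4 * smoothedExp α ε x ^ 2 * (x / √(x ^ 2 + ε ^ 2)) ^ 2 := by ring
    _ ≤ α ^ 2 / 4 * smoothedExp α ε x ^ 2 := mul_le_of_le_one_right (by positivity) h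

lemma integral_smoothedExp_sq_le {L α ε : ℝ} (hL : 0 < L) (hα : 0 < α) (hε : 0 < ε) :
    ∫ x in (-L)..L, smoothedExp α ε x ^ 2 ≤
      2 * (Real.exp (α * ε) * ((1 - Real.exp (-(L * α))) / α)) := by
  have hc : Continuous (smoothedExp α ε) := (contDiff_smoothedExp α hε).continuous
  have heven : ∀ x, smoothedExp α ε (-x) = smoothedExp α ε x := fun x => by
    simp [smoothedExp]
  rw [integral_neg_self_eq_add (f := fun x => smoothedExp α ε x ^ 2) (hc.pow 2)]
  simp only [heven]
  have h : ∫ x in (0)..L, smoothedExp α ε x ^ 2 ≤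
      ∫ x in (0)..L, Real.exp (α * ε) * Real.exp (-α * x) :=
    intervalIntegral.integral_mono_on hL.le ((hc.pow 2).intervalIntegrable _ _)
      (Continuous.intervalIntegrable (by fun_prop) _ _) fun x _ => smoothedExp_sq_le hα ε x
  have hi : ∫ x in (0)..L, Real.exp (-α * x) = (1 - Real.exp (-(L * α))) / α := by
    rw [intervalIntegral.integral_comp_mul_left (fun y => Real.exp y) (neg_ne_zero.2 hα.ne'),
      integral_exp]
    rw [mul_zero, Real.exp_zero, smul_eq_mul, neg_mul, mul_comm α L]
    field_simp
    ring
  rw [intervalIntegral.integral_const_mul, hi] at h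
  linarith

lemma exists_rayleigh_lt {L α : ℝ} (hL : 0 < L) (hα : 0 < α) :
    ∃ u : ℝ → ℂ, ContDiff ℝ 1 u ∧ (∃ x ∈ Set.Icc (-L) L, u x ≠ 0) ∧
      tForm L α u / (∫ x in (-L)..L, ‖u x‖ ^ 2) < -α ^ 2 / 4 := by
  set q := Real.exp (-(L * α)) with hq
  have hq0 : 0 < q := Real.exp_pos _
  set ε := Real.log (1 + q) / α with hεdef
  have hε : 0 < ε := div_pos (Real.log_pos (by linarith)) hα
  have hexp : Real.exp (α * ε) = 1 + q := by
    rw [hεdef, mul_div_cancel₀ _ hα.ne', Real.exp_log (by linarith)]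
  have hs := contDiff_smoothedExp α hε
  have hd : ∀ x, deriv (fun y => (smoothedExp α ε y : ℂ)) x = (deriv (smoothedExp α ε) x : ℝ) :=
    fun x => (hs.differentiable one_ne_zero x).hasDerivAt.ofReal_comp.deriv
  have h0 : smoothedExp α ε 0 = 1 := by
    simp [smoothedExp, Real.sqrt_sq hε.le]
  refine ⟨fun x => (smoothedExp α ε x : ℂ), Complex.ofRealCLM.contDiff.comp hs,
    ⟨0, ⟨by linarith, hL.le⟩, by simp [h0]⟩, ?_⟩
  simp only [tForm, hd, Complex.norm_real, Real.norm_eq_abs, sq_abs, h0, one_pow, mul_one]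
  have hN := integral_smoothedExp_sq_le hL hα hε
  rw [hexp] at hN
  have hNpos : 0 < ∫ x in (-L)..L, smoothedExp α ε x ^ 2 :=
    intervalIntegral.intervalIntegral_pos_of_pos ((hs.continuous.pow 2).intervalIntegrable _ _)
      (fun x => pow_pos (Real.exp_pos _) 2) (by linarith)
  have hD : ∫ x in (-L)..L, deriv (smoothedExp α ε) x ^ 2 ≤
      ∫ x in (-L)..L, α ^ 2 / 4 * smoothedExp α ε x ^ 2 :=
    intervalIntegral.integral_mono_on (by linarith)
      (((hs.continuous_deriv le_rfl).pow 2).intervalIntegrable _ _)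
      ((continuous_const.mul (hs.continuous.pow 2)).intervalIntegrable _ _)
      fun x _ => deriv_smoothedExp_sq_le α hε x
  rw [intervalIntegral.integral_const_mul] at hD
  rw [div_lt_iff₀ hNpos]
  set N := ∫ x in (-L)..L, smoothedExp α ε x ^ 2
  have hNα : N * α < 2 := by
    have h1 : 2 * ((1 + q) * ((1 - q) / α)) * α = 2 * (1 - q ^ 2) := by
      field_simp
      ring
    nlinarith
  nlinarith

theorem stmt6 : ∃ C > (0 : ℝ), ∃ M > (0 : ℝ), ∀ L α : ℝ, 0 < L → 0 < α → M ≤ L * α →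
    -α ^ 2 / 4 - C * α ^ 2 * Real.exp (-(L * α) / 2) ≤ lambda1Neumann L α ∧
      lambda1Neumann L α < -α ^ 2 / 4 := by
  refine ⟨4, by norm_num, 1, one_pos, fun L α hL hα h => ?_⟩
  obtain ⟨κ, hκ, hκ2⟩ := exists_le_two_mul_tanh hL hα h
  obtain ⟨u, hu, hne, hlt⟩ := exists_rayleigh_lt hL hα
  constructor
  · refine le_csInf ⟨_, u, hu, hne, rfl⟩ ?_
    rintro r ⟨v, hv, -, rfl⟩
    have := neg_sq_le_rayleigh hv hL.le hκ
    linarith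
  · refine csInf_lt_of_lt ⟨-κ ^ 2, ?_⟩ ⟨u, hu, hne, rfl⟩ hlt
    rintro r ⟨v, hv, -, rfl⟩
    exact neg_sq_le_rayleigh hv hL.le hκ
end

section
/- There exist constants C > 0 and M > 0 such that for all L > 0 and α > 0 with L·α ≥ M, the first min-max value Λ₁ := inf over nonzero u ∈ D of t_{L,α}(u)/∫_{−L}^{L}|u(x)|² dx, taken over D := {u ∈ C¹([−L,L]; ℂ) : u(L) = 0}, satisfies Λ₁ ≥ −α²/4 − C·α²·e^{−Lα/2}. -/
open MeasureTheory

/-- The first min-max value of `t_{L,α}` with a Neumann condition at `-L` and a Dirichlet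
condition at `L`: the infimum of the Rayleigh quotient over nonzero `C¹` functions
vanishing at `L`. -/
noncomputable def lambda1ND (L α : ℝ) : ℝ :=
  sInf {r : ℝ | ∃ u : ℝ → ℂ, ContDiff ℝ 1 u ∧ u L = 0 ∧
    (∃ x ∈ Set.Icc (-L) L, u x ≠ 0) ∧
    r = tForm L α u / ∫ x in (-L)..L, ‖u x‖ ^ 2}

/-- Weighted lower bound for the energy: if `φ` solves the Riccati equation `φ' = k² - φ²`, then
completing the square gives `[φ |u|²]_a^b ≤ ∫ |u'|² + k² ∫ |u|²`. -/
theorem riccati_energy_bound {a b k : ℝ} (hab : a ≤ b) {u : ℝ → ℂ} (hu : ContDiff ℝ 1 u)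
    {φ : ℝ → ℝ} (hφ : ∀ x, HasDerivAt φ (k ^ 2 - φ x ^ 2) x) :
    φ b * ‖u b‖ ^ 2 - φ a * ‖u a‖ ^ 2 ≤
      (∫ x in a..b, ‖deriv u x‖ ^ 2) + k ^ 2 * ∫ x in a..b, ‖u x‖ ^ 2 := by
  have hcu : Continuous u := hu.continuous
  have hcu' : Continuous (deriv u) := hu.continuous_deriv le_rfl
  have hcφ : Continuous φ := continuous_iff_continuousAt.2 fun x => (hφ x).continuousAt
  have hd : ∀ x, HasDerivAt (fun x => φ x * ‖u x‖ ^ 2)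
      ((k ^ 2 - φ x ^ 2) * ‖u x‖ ^ 2 + φ x * (2 * inner ℝ (u x) (deriv u x))) x := fun x =>
    (hφ x).mul ((hu.differentiable one_ne_zero x).hasDerivAt.norm_sq)
  have hcd : Continuous fun x =>
      (k ^ 2 - φ x ^ 2) * ‖u x‖ ^ 2 + φ x * (2 * inner ℝ (u x) (deriv u x)) := by
    fun_prop
  have hi₁ : Continuous fun x => ‖deriv u x‖ ^ 2 := by fun_prop
  have hi₂ : Continuous fun x => k ^ 2 * ‖u x‖ ^ 2 := by fun_prop
  rw [← intervalIntegral.integral_eq_sub_of_hasDerivAt (fun x _ => hd x)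
      (hcd.intervalIntegrable a b), ← intervalIntegral.integral_const_mul,
    ← intervalIntegral.integral_add (hi₁.intervalIntegrable a b) (hi₂.intervalIntegrable a b)]
  refine intervalIntegral.integral_mono_on hab (hcd.intervalIntegrable a b)
    ((hi₁.add hi₂).intervalIntegrable a b) fun x _ => ?_
  have h := norm_sub_sq_real (deriv u x) (φ x • u x)
  rw [inner_smul_right, norm_smul, mul_pow, Real.norm_eq_abs, sq_abs,
    real_inner_comm] at h
  have h₀ := sq_nonneg ‖deriv u x - φ x • u x‖
  linarith

/-- The function `k tanh (k (x - c))` solves the Riccati equation `φ' = k² - φ²`. -/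
theorem hasDerivAt_mul_tanh_riccati (k c x : ℝ) :
    HasDerivAt (fun x => k * Real.tanh (k * (x - c)))
      (k ^ 2 - (k * Real.tanh (k * (x - c))) ^ 2) x := by
  have hl : HasDerivAt (fun x => k * (x - c)) k x := by
    simpa using ((hasDerivAt_id x).sub_const c).const_mul k
  have hc : Real.cosh (k * (x - c)) ≠ 0 := (Real.cosh_pos _).ne'
  have h := (hl.sinh.div hl.cosh hc).const_mul k
  simp only [Real.tanh_eq_sinh_div_cosh]
  refine h.congr_deriv ?_
  field_simp

/-- Lower bound on the form with a spectral parameter `k` satisfying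
`α ≤ k (1 + tanh (k L))`. -/
theorem neg_sq_mul_le_tForm {L α k : ℝ} (hL : 0 ≤ L)
    (hα : α ≤ k * (1 + Real.tanh (k * L))) {u : ℝ → ℂ} (hu : ContDiff ℝ 1 u) (huL : u L = 0) :
    -k ^ 2 * (∫ x in (-L)..L, ‖u x‖ ^ 2) ≤ tForm L α u := by
  have hcu : Continuous u := hu.continuous
  have hcu' : Continuous (deriv u) := hu.continuous_deriv le_rfl
  have hi₁ : Continuous fun x => ‖deriv u x‖ ^ 2 := by fun_prop
  have hi₂ : Continuous fun x => ‖u x‖ ^ 2 := by fun_prop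
  have hl := riccati_energy_bound (neg_nonpos.2 hL) hu (hasDerivAt_mul_tanh_riccati k (-L))
  have hr := riccati_energy_bound (k := k) (φ := fun _ => -k) hL hu fun x => by
    simpa using hasDerivAt_const x (-k)
  simp only [huL, sub_neg_eq_add, zero_add, neg_add_cancel, mul_zero, Real.tanh_zero, norm_zero,
    zero_mul, sub_zero, ne_eq, OfNat.ofNat_ne_zero, not_false_eq_true, zero_pow] at hl hr
  unfold tForm
  rw [← intervalIntegral.integral_add_adjacent_intervals (hi₁.intervalIntegrable (-L) 0)
      (hi₁.intervalIntegrable 0 L),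
    ← intervalIntegral.integral_add_adjacent_intervals (hi₂.intervalIntegrable (-L) 0)
      (hi₂.intervalIntegrable 0 L)]
  have h := mul_le_mul_of_nonneg_right hα (sq_nonneg ‖u 0‖)
  linarith

theorem le_mul_one_add_tanh {L α : ℝ} (hL : 0 ≤ L) (hα : 0 ≤ α) :
    α ≤ α / 2 * (1 + Real.exp (-(L * α))) *
      (1 + Real.tanh (α / 2 * (1 + Real.exp (-(L * α))) * L)) := by
  set y := α / 2 * (1 + Real.exp (-(L * α))) * L with hy
  have hy' : L * α ≤ 2 * y := by
    have := mul_nonneg (mul_nonneg hL hα) (Real.exp_pos (-(L * α))).le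
    rw [hy]; linarith
  have ht : (1 + Real.tanh y) * (1 + Real.exp (-(2 * y))) = 2 := by
    have h₁ : Real.exp (-(2 * y)) = Real.exp (-y) * Real.exp (-y) := by
      rw [← Real.exp_add]; ring_nf
    have h₂ : Real.exp y * Real.exp (-y) = 1 := by rw [← Real.exp_add]; simp
    have := Real.exp_pos y
    have := Real.exp_pos (-y)
    rw [Real.tanh_eq, h₁]
    field_simp
    linear_combination 2 * Real.exp (-y) * h₂
  have he : Real.exp (-(2 * y)) ≤ Real.exp (-(L * α)) := Real.exp_le_exp.2 (by linarith)
  have h1 : 0 ≤ 1 + Real.tanh y := by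
    by_contra! h
    nlinarith [Real.exp_pos (-(2 * y))]
  have h2 : 2 ≤ (1 + Real.tanh y) * (1 + Real.exp (-(L * α))) := by
    rw [← ht]; gcongr
  nlinarith

theorem stmt10 : ∃ C > (0 : ℝ), ∃ M > (0 : ℝ), ∀ L α : ℝ, 0 < L → 0 < α → M ≤ L * α →
    -α ^ 2 / 4 - C * α ^ 2 * Real.exp (-(L * α) / 2) ≤ lambda1ND L α := by
  refine ⟨1, one_pos, 1, one_pos, fun L α hL hα _ => ?_⟩
  have he : Real.exp (-(L * α)) ≤ Real.exp (-(L * α) / 2) :=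
    Real.exp_le_exp.2 (by nlinarith [mul_pos hL hα])
  have he₁ : Real.exp (-(L * α)) ≤ 1 := Real.exp_le_one_iff.2 (by nlinarith [mul_pos hL hα])
  have he₀ := Real.exp_pos (-(L * α))
  have hk : -α ^ 2 / 4 - 1 * α ^ 2 * Real.exp (-(L * α) / 2) ≤
      -(α / 2 * (1 + Real.exp (-(L * α)))) ^ 2 := by
    have h : (1 + Real.exp (-(L * α))) ^ 2 ≤ 1 + 4 * Real.exp (-(L * α) / 2) := by nlinarith
    have := mul_le_mul_of_nonneg_left h (sq_nonneg (α / 2))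
    rw [mul_pow]
    linarith
  refine hk.trans (Real.le_sInf ?_ (neg_nonpos.2 (sq_nonneg _)))
  rintro r ⟨u, hu, huL, -, rfl⟩
  have ht := neg_sq_mul_le_tForm hL.le (le_mul_one_add_tanh hL.le hα.le) hu huL
  have hn : 0 ≤ ∫ x in (-L)..L, ‖u x‖ ^ 2 :=
    intervalIntegral.integral_nonneg (by linarith) fun x _ => sq_nonneg _
  rcases hn.eq_or_lt with h | h
  · rw [← h, div_zero]
    exact neg_nonpos.2 (sq_nonneg _)
  · exact (le_div_iff₀ h).2 ht
end

section
/- For every θ ∈ (0, π), every α > 0, and every compactly supported continuously differentiable function u : ℝ² → ℂ, one has h^α_θ(u) ≥ −(α²/(4·sin²θ)) · ∫_{ℝ²} |u(x)|² dx. -/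
open MeasureTheory

/-- The quadratic form `h^α_θ` of the two-dimensional Schrödinger operator `−Δ − αδ_{Γ_θ}`
with attractive δ-interaction of strength `α` supported on the broken line
`Γ_θ = {(r cos θ, ±r sin θ) : r ≥ 0}`, evaluated on a `C¹` function `u : ℝ² → ℂ`:
`h^α_θ(u) = ∫_{ℝ²} ‖∇u‖² − α(∫₀^∞ |u(r cos θ, r sin θ)|² dr + ∫₀^∞ |u(r cos θ, −r sin θ)|² dr)`. -/
noncomputable def hFormBroken (θ α : ℝ) (u : ℝ × ℝ → ℂ) : ℝ :=
  (∫ x : ℝ × ℝ, (‖fderiv ℝ u x (1, 0)‖ ^ 2 + ‖fderiv ℝ u x (0, 1)‖ ^ 2)) -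
    α * ((∫ r in Set.Ioi (0 : ℝ), ‖u (r * Real.cos θ, r * Real.sin θ)‖ ^ 2) +
      ∫ r in Set.Ioi (0 : ℝ), ‖u (r * Real.cos θ, -(r * Real.sin θ))‖ ^ 2)

/-- The squared norm of a compactly supported continuous function is integrable. -/
theorem HasCompactSupport.integrable_norm_sq {X E : Type*} [TopologicalSpace X]
    [MeasurableSpace X] [OpensMeasurableSpace X] {μ : Measure X} [IsFiniteMeasureOnCompacts μ]
    [NormedAddCommGroup E] {f : X → E} (hc : HasCompactSupport f) (hf : Continuous f) :
    Integrable (fun x => ‖f x‖ ^ 2) μ := by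
  have hcont : Continuous fun x => ‖f x‖ ^ 2 := by fun_prop
  have hsupp : HasCompactSupport fun x => ‖f x‖ ^ 2 :=
    hc.mono fun x hx hfx => hx (by simp [hfx])
  exact hcont.integrable_of_hasCompactSupport hsupp

/-- One-dimensional trace inequality: the operator `-d²/dx² - βδ_a` on the real line is bounded
below by `-β²/4`. -/
theorem mul_norm_sq_le_integral_deriv_sq {f : ℝ → ℂ} (hf : ContDiff ℝ 1 f)
    (hc : HasCompactSupport f) {β : ℝ} (hβ : 0 ≤ β) (a : ℝ) :
    β * ‖f a‖ ^ 2 ≤ ∫ x, (‖deriv f x‖ ^ 2 + β ^ 2 / 4 * ‖f x‖ ^ 2) := by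
  have hgd : ContDiff ℝ 1 (fun x => ‖f x‖ ^ 2) := hf.norm_sq ℝ
  have hgc : HasCompactSupport (fun x => ‖f x‖ ^ 2) :=
    hc.comp_left (g := fun z : ℂ => ‖z‖ ^ 2) (by simp)
  have hh : Integrable (fun x => ‖deriv f x‖ ^ 2 + β ^ 2 / 4 * ‖f x‖ ^ 2) :=
    (hc.deriv.integrable_norm_sq (hf.continuous_deriv le_rfl)).add
      ((hc.integrable_norm_sq hf.continuous).const_mul _)
  have hg' : Integrable (deriv fun x => ‖f x‖ ^ 2) :=
    (hgd.continuous_deriv le_rfl).integrable_of_hasCompactSupport hgc.deriv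
  have key : ∀ x, |β * deriv (fun x => ‖f x‖ ^ 2) x|
      ≤ 2 * (‖deriv f x‖ ^ 2 + β ^ 2 / 4 * ‖f x‖ ^ 2) := by
    intro x
    rw [((hf.differentiable one_ne_zero x).hasDerivAt.norm_sq).deriv, abs_mul, abs_mul,
      abs_of_nonneg hβ, abs_two]
    have := mul_le_mul_of_nonneg_left (abs_real_inner_le_norm (f x) (deriv f x)) hβ
    nlinarith [sq_nonneg (‖deriv f x‖ - β / 2 * ‖f x‖)]
  have left : β * ‖f a‖ ^ 2
      ≤ ∫ x in Set.Iic a, 2 * (‖deriv f x‖ ^ 2 + β ^ 2 / 4 * ‖f x‖ ^ 2) := by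
    rw [← hgc.integral_Iic_deriv_eq hgd a, ← integral_const_mul]
    exact integral_mono (hg'.const_mul β).integrableOn (hh.const_mul 2).integrableOn
      fun x => (abs_le.1 (key x)).2
  have right : β * ‖f a‖ ^ 2
      ≤ ∫ x in Set.Ioi a, 2 * (‖deriv f x‖ ^ 2 + β ^ 2 / 4 * ‖f x‖ ^ 2) := by
    rw [← neg_neg (‖f a‖ ^ 2), ← hgc.integral_Ioi_deriv_eq hgd a, mul_neg, ← integral_const_mul,
      ← integral_neg]
    exact integral_mono (hg'.const_mul β).neg.integrableOn (hh.const_mul 2).integrableOn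
      fun x => neg_le.1 (abs_le.1 (key x)).1
  have split := intervalIntegral.integral_Iic_add_Ioi (b := a)
    (hh.const_mul 2).integrableOn (hh.const_mul 2).integrableOn
  rw [integral_const_mul (μ := volume)] at split
  linarith

/-- Trace inequality for a ray emanating from the origin and transversal to the first axis,
obtained by slicing along lines parallel to that axis. -/
theorem mul_integral_ray_le {u : ℝ × ℝ → ℂ} {c s α : ℝ} (hs : 0 < s) {G : ℝ → ℝ}
    (hG : Integrable G) (hα : 0 ≤ α)
    (h : ∀ a y, α / s * ‖u (a, y)‖ ^ 2 ≤ G y) :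
    α * ∫ r in Set.Ioi (0 : ℝ), ‖u (r * c, r * s)‖ ^ 2 ≤ ∫ y in Set.Ioi (0 : ℝ), G y := by
  have hsub := integral_comp_mul_right_Ioi (fun y => ‖u (y * (c / s), y)‖ ^ 2) 0 hs
  have harg : ∀ r, r * s * (c / s) = r * c := fun r => by field_simp
  simp only [harg, zero_mul, smul_eq_mul] at hsub
  rw [hsub, ← mul_assoc, ← div_eq_mul_inv, ← integral_const_mul]
  exact integral_mono_of_nonneg (Filter.Eventually.of_forall fun y => by positivity)
    hG.integrableOn (Filter.Eventually.of_forall fun y => h _ y)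

theorem stmt12 : ∀ θ ∈ Set.Ioo (0 : ℝ) Real.pi, ∀ α : ℝ, 0 < α →
    ∀ u : ℝ × ℝ → ℂ, HasCompactSupport u → ContDiff ℝ 1 u →
      hFormBroken θ α u ≥
        -(α ^ 2 / (4 * Real.sin θ ^ 2)) * ∫ x : ℝ × ℝ, ‖u x‖ ^ 2 := by
  intro θ hθ α hα u hc hu
  have hs : 0 < Real.sin θ := Real.sin_pos_of_mem_Ioo hθ
  set s := Real.sin θ
  set c := Real.cos θ
  have hd : ∀ v, Integrable fun x => ‖fderiv ℝ u x v‖ ^ 2 := fun v =>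
    (hc.fderiv_apply ℝ v).integrable_norm_sq
      ((hu.continuous_fderiv one_ne_zero).clm_apply continuous_const)
  have hn : Integrable fun x => ‖u x‖ ^ 2 := hc.integrable_norm_sq hu.continuous
  have hF : Integrable fun x : ℝ × ℝ =>
      ‖fderiv ℝ u x (1, 0)‖ ^ 2 + (α / s) ^ 2 / 4 * ‖u x‖ ^ 2 := (hd _).add (hn.const_mul _)
  set G : ℝ → ℝ := fun y =>
    ∫ x, (‖fderiv ℝ u (x, y) (1, 0)‖ ^ 2 + (α / s) ^ 2 / 4 * ‖u (x, y)‖ ^ 2)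
  have hG : Integrable G := hF.integral_prod_right
  have hGF : ∫ y, G y = ∫ x, (‖fderiv ℝ u x (1, 0)‖ ^ 2 + (α / s) ^ 2 / 4 * ‖u x‖ ^ 2) :=
    (integral_prod_symm _ hF).symm
  have hslice : ∀ a y, α / s * ‖u (a, y)‖ ^ 2 ≤ G y := by
    intro a y
    have hder : ∀ x, deriv (fun t => u (t, y)) x = fderiv ℝ u (x, y) (1, 0) := fun x =>
      ((hu.differentiable one_ne_zero (x, y)).hasFDerivAt.comp_hasDerivAt x
        ((hasDerivAt_id x).prodMk (hasDerivAt_const x y))).deriv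
    have hcy : HasCompactSupport fun t => u (t, y) :=
      hc.comp_isClosedEmbedding (Isometry.of_dist_eq fun t t' => by
        simp [Prod.dist_eq]).isClosedEmbedding
    have := mul_norm_sq_le_integral_deriv_sq (f := fun t => u (t, y))
      (hu.comp (contDiff_id.prodMk contDiff_const)) hcy (div_pos hα hs).le a
    simpa only [hder] using this
  have hup := mul_integral_ray_le (c := c) hs hG hα.le hslice
  have hdown := mul_integral_ray_le (u := fun p => u (p.1, -p.2)) (c := c) hs hG.comp_neg hα.le
    fun a y => hslice a (-y)
  rw [integral_comp_neg_Ioi, neg_zero] at hdown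
  have hsplit := intervalIntegral.integral_Iic_add_Ioi (b := (0 : ℝ))
    hG.integrableOn hG.integrableOn
  rw [hGF, integral_add (hd _) (hn.const_mul _), integral_const_mul] at hsplit
  have hpos : 0 ≤ ∫ x, ‖fderiv ℝ u x (0, 1)‖ ^ 2 := integral_nonneg fun x => by positivity
  have hcoef : (α / s) ^ 2 / 4 = α ^ 2 / (4 * s ^ 2) := by field_simp
  rw [hcoef] at hsplit
  rw [hFormBroken, integral_add (hd _) (hd _)]
  linarith
end

section
/- Fix n ≥ 1, l > 0, b ≥ 0, a Lipschitz continuous function k : [0,l] → ℝ, and C₀ > 0. For real numbers a₀, a₁ ≥ 0 with a₀ + a₁ < l and a constant c > 0, let Λₙ(a₀, a₁; c) denote the infimum over all n-dimensional linear subspaces V of the space of C¹ functions u : ℝ → ℂ with compact support contained in the open interval (a₀, l − a₁) of the supremum over nonzero u ∈ V of (c·∫ |u'(s)|² ds − ∫ (k(s)²/4)·|u(s)|² ds) / ∫ |u(s)|² ds. Then there exist C > 0 and δ₁ > 0 such that for every δ ∈ (0, δ₁) and all a₀, a₁ ∈ [0, C₀·δ], one has |Λₙ(a₀, a₁; 1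 + b·δ) − Λₙ(0, 0; 1)| ≤ C·δ. -/
open MeasureTheory

/-- `lambdaDir n l k a₀ a₁ c` is the `n`-th min-max value of the one-dimensional
Schrödinger operator `−c·d²/ds² − k(s)²/4` on the interval `(a₀, l − a₁)` with Dirichlet
boundary conditions, expressed via the min-max principle over the form core of `C¹`
functions with compact support contained in `(a₀, l − a₁)`. -/
noncomputable def lambdaDir (n : ℕ) (l : ℝ) (k : ℝ → ℝ) (a₀ a₁ c : ℝ) : ℝ :=
  sInf {r : ℝ | ∃ V : Submodule ℂ (ℝ → ℂ),
    (∀ u ∈ V, ContDiff ℝ 1 u ∧ HasCompactSupport u ∧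
      tsupport u ⊆ Set.Ioo a₀ (l - a₁)) ∧
    Module.finrank ℂ V = n ∧
    r = sSup {s : ℝ | ∃ u ∈ V, u ≠ 0 ∧
      s = (c * (∫ x : ℝ, ‖deriv u x‖ ^ 2) - ∫ x : ℝ, (k x ^ 2 / 4) * ‖u x‖ ^ 2) /
        ∫ x : ℝ, ‖u x‖ ^ 2}}

lemma abs_sSup_sub_sSup_le {A B : Set ℝ} {e : ℝ} (he : 0 ≤ e)
    (hA : ∀ a ∈ A, ∃ b ∈ B, |b - a| ≤ e) (hB : ∀ b ∈ B, ∃ a ∈ A, |b - a| ≤ e) :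
    |sSup B - sSup A| ≤ e := by
  rcases A.eq_empty_or_nonempty with rfl | hAne
  · have hBe : B = ∅ := by
      refine Set.eq_empty_iff_forall_notMem.2 fun b hb => ?_
      obtain ⟨a, ha, -⟩ := hB b hb
      exact ha
    simpa [hBe] using he
  have hBne : B.Nonempty := by
    obtain ⟨a, ha⟩ := hAne
    obtain ⟨b, hb, -⟩ := hA a ha
    exact ⟨b, hb⟩
  by_cases hAb : BddAbove A
  · have hle : ∀ b ∈ B, b ≤ sSup A + e := fun b hb => by
      obtain ⟨a, ha, hab⟩ := hB b hb
      have := le_csSup hAb ha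
      have := (abs_le.1 hab).2
      linarith
    have hBb : BddAbove B := ⟨_, hle⟩
    have h₁ : sSup B ≤ sSup A + e := csSup_le hBne hle
    have h₂ : sSup A ≤ sSup B + e := csSup_le hAne fun a ha => by
      obtain ⟨b, hb, hab⟩ := hA a ha
      have := le_csSup hBb hb
      have := (abs_le.1 hab).1
      linarith
    exact abs_le.2 ⟨by linarith, by linarith⟩
  · have hBb : ¬ BddAbove B := by
      rintro ⟨M, hM⟩
      refine hAb ⟨M + e, fun a ha => ?_⟩
      obtain ⟨b, hb, hab⟩ := hA a ha
      have := hM hb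
      have := (abs_le.1 hab).1
      linarith
    simpa [Real.sSup_of_not_bddAbove hAb, Real.sSup_of_not_bddAbove hBb] using he

open scoped Pointwise in
lemma abs_sSup_sub_mul_sSup_le {A B : Set ℝ} {t e : ℝ} (ht : 0 ≤ t) (he : 0 ≤ e)
    (hA : ∀ a ∈ A, ∃ b ∈ B, |b - t * a| ≤ e) (hB : ∀ b ∈ B, ∃ a ∈ A, |b - t * a| ≤ e) :
    |sSup B - t * sSup A| ≤ e := by
  rw [← smul_eq_mul, ← Real.sSup_smul_of_nonneg ht]
  refine abs_sSup_sub_sSup_le he ?_ fun b hb => ?_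
  · rintro _ ⟨a, ha, rfl⟩
    exact hA a ha
  · obtain ⟨a, ha, h⟩ := hB b hb
    exact ⟨t * a, Set.smul_mem_smul_set ha, h⟩

open scoped Pointwise in
lemma abs_sInf_sub_mul_sInf_le {A B : Set ℝ} {t e : ℝ} (ht : 0 ≤ t) (he : 0 ≤ e)
    (hA : ∀ a ∈ A, ∃ b ∈ B, |b - t * a| ≤ e) (hB : ∀ b ∈ B, ∃ a ∈ A, |b - t * a| ≤ e) :
    |sInf B - t * sInf A| ≤ e := by
  have key : ∀ a b : ℝ, |-b - t * -a| = |b - t * a| := fun a b => by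
    rw [← abs_neg]
    congr 1
    ring
  rw [Real.sInf_def, Real.sInf_def, key]
  refine abs_sSup_sub_mul_sSup_le ht he (fun a ha => ?_) fun b hb => ?_
  · obtain ⟨b, hb, h⟩ := hA (-a) ha
    exact ⟨-b, by simpa using hb, by rwa [← key, neg_neg]⟩
  · obtain ⟨a, ha, h⟩ := hB (-b) hb
    exact ⟨-a, by simpa using ha, by rwa [← key, neg_neg]⟩

/-- Precomposition with `x ↦ a * x + b`, as a linear automorphism of `ℝ → ℂ`. -/
noncomputable def affineComp (a b : ℝ) (ha : a ≠ 0) : (ℝ → ℂ) ≃ₗ[ℂ] (ℝ → ℂ) :=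
  LinearEquiv.funCongrLeft ℂ ℂ (affineHomeomorph a b ha).toEquiv

/-- Membership in the form core on `(p, q)`. -/
def IsTestFun (p q : ℝ) (u : ℝ → ℂ) : Prop :=
  ContDiff ℝ 1 u ∧ HasCompactSupport u ∧ tsupport u ⊆ Set.Ioo p q

lemma IsTestFun.comp_homeomorph {p q p' q' : ℝ} {u : ℝ → ℂ} (hu : IsTestFun p q u)
    (φ : ℝ ≃ₜ ℝ) (hφ : ContDiff ℝ 1 φ) (h : ∀ x, φ x ∈ Set.Ioo p q → x ∈ Set.Ioo p' q') :
    IsTestFun p' q' (u ∘ φ) := by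
  refine ⟨hu.1.comp hφ, hu.2.1.comp_homeomorph φ, ?_⟩
  rw [tsupport_comp_eq_preimage]
  exact fun x hx => h x (hu.2.2 hx)

lemma IsTestFun.integrable_mul {p q : ℝ} {u : ℝ → ℂ} (hu : IsTestFun p q u) {f : ℝ → ℝ}
    (hf : ContinuousOn f (Set.Icc p q)) : Integrable fun x => f x * ‖u x‖ ^ 2 := by
  have hs : (Function.support fun x => f x * ‖u x‖ ^ 2) ⊆ Set.Icc p q := fun x hx => by
    refine Set.Ioo_subset_Icc_self (hu.2.2 (subset_tsupport _ fun h0 => hx ?_))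
    simp [h0]
  rw [← integrableOn_iff_integrable_of_support_subset hs]
  exact (hf.mul (hu.1.continuous.norm.pow 2).continuousOn).integrableOn_Icc

lemma IsTestFun.abs_integral_mul_le {p q : ℝ} {u : ℝ → ℂ} (hu : IsTestFun p q u) {f : ℝ → ℝ}
    {Q : ℝ} (hQ : ∀ x ∈ Set.Icc p q, |f x| ≤ Q) :
    |∫ x, f x * ‖u x‖ ^ 2| ≤ Q * ∫ x, ‖u x‖ ^ 2 := by
  rw [← integral_const_mul, ← Real.norm_eq_abs]
  refine norm_integral_le_of_norm_le (hu.integrable_mul continuousOn_const)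
    (Filter.Eventually.of_forall fun x => ?_)
  by_cases h0 : u x = 0
  · simp [h0]
  · rw [norm_mul, Real.norm_eq_abs, norm_pow, norm_norm]
    gcongr
    exact hQ x (Set.Ioo_subset_Icc_self (hu.2.2 (subset_tsupport _ h0)))

lemma integral_comp_sub_div {r : ℝ} (hr : 0 < r) (d : ℝ) (g : ℝ → ℝ) :
    ∫ x, g ((x - d) / r) = r * ∫ x, g x := by
  rw [integral_sub_right_eq_self (fun x => g (x / r)) d, Measure.integral_comp_div,
    abs_of_pos hr, smul_eq_mul]

lemma deriv_comp_sub_div (r d : ℝ) (u : ℝ → ℂ) (x : ℝ) :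
    deriv (fun x => u ((x - d) / r)) x = r⁻¹ • deriv u ((x - d) / r) := by
  rw [deriv_comp_sub_const (f := fun x => u (x / r))]
  simp only [div_eq_inv_mul]
  rw [deriv_comp_mul_left]

/-- The Rayleigh quotient of `−c·d²/ds² − k(s)²/4`. -/
noncomputable def rayleigh (k : ℝ → ℝ) (c : ℝ) (u : ℝ → ℂ) : ℝ :=
  (c * (∫ x : ℝ, ‖deriv u x‖ ^ 2) - ∫ x : ℝ, (k x ^ 2 / 4) * ‖u x‖ ^ 2) / ∫ x : ℝ, ‖u x‖ ^ 2

lemma rayleigh_comp_sub_div (k : ℝ → ℝ) (c : ℝ) (u : ℝ → ℂ) {r : ℝ} (hr : 0 < r) (d : ℝ) :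
    rayleigh k c (fun x => u ((x - d) / r)) =
      (c / r ^ 2 * (∫ x : ℝ, ‖deriv u x‖ ^ 2) -
        ∫ x : ℝ, (k (r * x + d) ^ 2 / 4) * ‖u x‖ ^ 2) / ∫ x : ℝ, ‖u x‖ ^ 2 := by
  have h₁ : ∫ x, ‖deriv (fun x => u ((x - d) / r)) x‖ ^ 2 =
      r * (r⁻¹ ^ 2 * ∫ x, ‖deriv u x‖ ^ 2) := by
    rw [← integral_const_mul, ← integral_comp_sub_div hr d]
    simp only [deriv_comp_sub_div, norm_smul, mul_pow, norm_inv, Real.norm_eq_abs, inv_pow, sq_abs]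
  have h₂ : ∫ x, (k x ^ 2 / 4) * ‖u ((x - d) / r)‖ ^ 2 =
      r * ∫ x, (k (r * x + d) ^ 2 / 4) * ‖u x‖ ^ 2 := by
    rw [← integral_comp_sub_div hr d]
    congr! 6 with x
    field_simp
    ring
  rw [rayleigh, h₁, h₂, integral_comp_sub_div hr d (fun x => ‖u x‖ ^ 2),
    ← mul_div_mul_left _ (∫ x, ‖u x‖ ^ 2) hr.ne']
  congr 1
  field_simp

lemma abs_rayleigh_comp_sub_le {k : ℝ → ℝ} {c l r d Q E : ℝ} {u : ℝ → ℂ}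
    (hu : IsTestFun 0 l u) (hr : 0 < r) (hc : 1 ≤ c / r ^ 2) (hE : 0 ≤ E) (hQ0 : 0 ≤ Q)
    (hk : ContinuousOn k (Set.Icc 0 l)) (hmap : ∀ x ∈ Set.Icc 0 l, r * x + d ∈ Set.Icc 0 l)
    (hQ : ∀ x ∈ Set.Icc 0 l, k x ^ 2 / 4 ≤ Q)
    (hdiff : ∀ x ∈ Set.Icc 0 l, |k x ^ 2 / 4 - k (r * x + d) ^ 2 / 4| ≤ E) :
    |rayleigh k c (fun x => u ((x - d) / r)) - c / r ^ 2 * rayleigh k 1 u| ≤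
      (c / r ^ 2 - 1) * Q + E := by
  have hk' : ContinuousOn (fun x => k (r * x + d)) (Set.Icc 0 l) :=
    hk.comp (by fun_prop) hmap
  have hP := hu.abs_integral_mul_le (f := fun x => k x ^ 2 / 4) (Q := Q) fun x hx => by
    rw [abs_of_nonneg (by positivity)]
    exact hQ x hx
  have hPP := hu.abs_integral_mul_le hdiff
  simp only [sub_mul] at hPP
  rw [integral_sub (hu.integrable_mul (f := fun x => k x ^ 2 / 4) ((hk.pow 2).div_const 4))
    (hu.integrable_mul (f := fun x => k (r * x + d) ^ 2 / 4) ((hk'.pow 2).div_const 4))] at hPP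
  rw [rayleigh_comp_sub_div k c u hr d, rayleigh]
  set t := c / r ^ 2
  set D := ∫ x, ‖deriv u x‖ ^ 2
  set P := ∫ x, (k x ^ 2 / 4) * ‖u x‖ ^ 2
  set P' := ∫ x, (k (r * x + d) ^ 2 / 4) * ‖u x‖ ^ 2
  have hN : 0 ≤ ∫ x, ‖u x‖ ^ 2 := integral_nonneg fun x => by positivity
  set N := ∫ x, ‖u x‖ ^ 2
  have hrw : (t * D - P') / N - t * ((1 * D - P) / N) = ((t - 1) * P + (P - P')) / N := by ring
  have ht : 0 ≤ t - 1 := by linarith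
  rw [hrw, abs_div, abs_of_nonneg hN]
  refine div_le_of_le_mul₀ hN (by positivity) ?_
  calc |(t - 1) * P + (P - P')| ≤ |(t - 1) * P| + |P - P'| := abs_add_le _ _
    _ ≤ (t - 1) * (Q * N) + E * N := by
      rw [abs_mul, abs_of_nonneg ht]
      gcongr
    _ = ((t - 1) * Q + E) * N := by ring

/-- The affine change of variables mapping `(0, l)` onto `(a₀, l - a₁)` compares the min-max
values on these intervals. -/
lemma abs_lambdaDir_sub_le (n : ℕ) {k : ℝ → ℝ} {c l r a₀ a₁ Q E : ℝ}
    (hr : 0 < r) (hc : 1 ≤ c / r ^ 2) (hE : 0 ≤ E) (hQ0 : 0 ≤ Q)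
    (hk : ContinuousOn k (Set.Icc 0 l)) (ha₀ : 0 ≤ a₀) (ha₁ : 0 ≤ a₁) (hrl : r * l = l - a₀ - a₁)
    (hQ : ∀ x ∈ Set.Icc 0 l, k x ^ 2 / 4 ≤ Q)
    (hdiff : ∀ x ∈ Set.Icc 0 l, |k x ^ 2 / 4 - k (r * x + a₀) ^ 2 / 4| ≤ E) :
    |lambdaDir n l k a₀ a₁ c - c / r ^ 2 * lambdaDir n l k 0 0 1| ≤
      (c / r ^ 2 - 1) * Q + E := by
  have he : 0 ≤ (c / r ^ 2 - 1) * Q + E := by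
    have : 0 ≤ c / r ^ 2 - 1 := by linarith
    positivity
  have hmap : ∀ x ∈ Set.Icc 0 l, r * x + a₀ ∈ Set.Icc 0 l := fun x hx =>
    ⟨by have := mul_nonneg hr.le hx.1; linarith,
      by have := mul_le_mul_of_nonneg_left hx.2 hr.le; linarith⟩
  let T := (affineComp r a₀ hr.ne').symm
  have hsup : ∀ V : Submodule ℂ (ℝ → ℂ), (∀ u ∈ V, IsTestFun 0 (l - 0) u) →
      |sSup {s : ℝ | ∃ u ∈ V.map (T : (ℝ → ℂ) →ₗ[ℂ] (ℝ → ℂ)), u ≠ 0 ∧ s = rayleigh k c u} -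
        c / r ^ 2 * sSup {s : ℝ | ∃ u ∈ V, u ≠ 0 ∧ s = rayleigh k 1 u}| ≤
          (c / r ^ 2 - 1) * Q + E := by
    intro V hV
    have hR : ∀ u ∈ V, |rayleigh k c (T u) - c / r ^ 2 * rayleigh k 1 u| ≤
        (c / r ^ 2 - 1) * Q + E := fun u hu =>
      abs_rayleigh_comp_sub_le (by simpa using hV u hu) hr hc hE hQ0 hk hmap hQ hdiff
    refine abs_sSup_sub_mul_sSup_le (by linarith) he ?_ ?_
    · rintro _ ⟨u, hu, hu0, rfl⟩
      exact ⟨_, ⟨T u, Submodule.mem_map_of_mem hu, by simpa using hu0, rfl⟩, hR u hu⟩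
    · rintro _ ⟨_, ⟨u, hu, rfl⟩, hu0, rfl⟩
      exact ⟨_, ⟨u, hu, by simpa using hu0, rfl⟩, hR u hu⟩
  refine abs_sInf_sub_mul_sInf_le (by linarith) he ?_ ?_
  · rintro _ ⟨V, hV, hn, rfl⟩
    refine ⟨_, ⟨V.map (T : (ℝ → ℂ) →ₗ[ℂ] (ℝ → ℂ)), ?_, ?_, rfl⟩, hsup V hV⟩
    · rintro _ ⟨u, hu, rfl⟩
      refine IsTestFun.comp_homeomorph (hV u hu) (affineHomeomorph r a₀ hr.ne').symm ?_ ?_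
      · change ContDiff ℝ 1 fun x => (x - a₀) / r
        fun_prop
      · intro x hx
        change (x - a₀) / r ∈ _ at hx
        rw [Set.mem_Ioo, lt_div_iff₀ hr, div_lt_iff₀ hr] at hx
        constructor <;> nlinarith [hx.1, hx.2]
    · rw [← hn]
      exact LinearEquiv.finrank_map_eq T V
  · rintro _ ⟨W, hW, hn, rfl⟩
    have hV : ∀ u ∈ W.map (T.symm : (ℝ → ℂ) →ₗ[ℂ] (ℝ → ℂ)), IsTestFun 0 (l - 0) u := by
      rintro _ ⟨u, hu, rfl⟩
      refine IsTestFun.comp_homeomorph (hW u hu) (affineHomeomorph r a₀ hr.ne') ?_ ?_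
      · change ContDiff ℝ 1 fun x => r * x + a₀
        fun_prop
      · intro x hx
        change r * x + a₀ ∈ _ at hx
        have h₁ : 0 < r * x := by linarith [hx.1]
        have h₂ : r * x < r * l := by linarith [hx.2]
        exact ⟨pos_of_mul_pos_right h₁ hr.le, by simpa using lt_of_mul_lt_mul_left h₂ hr.le⟩
    have hWV : (W.map (T.symm : (ℝ → ℂ) →ₗ[ℂ] (ℝ → ℂ))).map (T : (ℝ → ℂ) →ₗ[ℂ] (ℝ → ℂ)) = W := by
      rw [← Submodule.map_comp]
      simp
    have := hsup _ hV
    rw [hWV] at this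
    refine ⟨_, ⟨_, hV, ?_, rfl⟩, this⟩
    rw [← hn]
    exact LinearEquiv.finrank_map_eq T.symm W

theorem stmt16 (n : ℕ) (hn : 1 ≤ n) (l : ℝ) (hl : 0 < l) (b : ℝ) (hb : 0 ≤ b)
    (k : ℝ → ℝ) (K : NNReal) (hk : LipschitzOnWith K k (Set.Icc 0 l))
    (C₀ : ℝ) (hC₀ : 0 < C₀) :
    ∃ C > (0 : ℝ), ∃ δ₁ > (0 : ℝ), ∀ δ : ℝ, 0 < δ → δ < δ₁ →
      ∀ a₀ a₁ : ℝ, a₀ ∈ Set.Icc 0 (C₀ * δ) → a₁ ∈ Set.Icc 0 (C₀ * δ) → a₀ + a₁ < l →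
        |lambdaDir n l k a₀ a₁ (1 + b * δ) - lambdaDir n l k 0 0 1| ≤ C * δ := by
  obtain ⟨M, hM⟩ := isCompact_Icc.exists_bound_of_continuousOn hk.continuousOn
  have hM0 : 0 ≤ M := (norm_nonneg _).trans (hM 0 ⟨le_rfl, hl.le⟩)
  simp only [Real.norm_eq_abs] at hM
  set L := lambdaDir n l k 0 0 1
  refine ⟨(4 * b + 16 * (C₀ / l)) * (|L| + M ^ 2 / 4) + K * C₀ * M / 2 + 1, by positivity,
    l / (4 * C₀), by positivity, fun δ hδ hδ₁ a₀ a₁ ha₀ ha₁ _ => ?_⟩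
  rw [lt_div_iff₀ (by positivity)] at hδ₁
  set r := (l - a₀ - a₁) / l with hr_def
  have hrl : r * l = l - a₀ - a₁ := by rw [hr_def]; field_simp
  have hr1 : r ≤ 1 := by
    rw [hr_def, div_le_one hl]; linarith [ha₀.1, ha₁.1]
  have hr2 : 1 / 2 ≤ r := by
    rw [hr_def, le_div_iff₀ hl]; linarith [ha₀.2, ha₁.2]
  have hr0 : 0 < r := by linarith
  have hr3 : 1 - r ≤ 2 * (C₀ / l) * δ := by
    have : 1 - r = (a₀ + a₁) / l := by rw [hr_def]; field_simp; ring
    rw [this, div_le_iff₀ hl]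
    have : 2 * (C₀ / l) * δ * l = 2 * (C₀ * δ) := by field_simp
    linarith [ha₀.2, ha₁.2]
  have ht1 : 1 ≤ (1 + b * δ) / r ^ 2 := by
    rw [one_le_div (by positivity)]
    nlinarith [mul_nonneg hb hδ.le]
  have ht2 : (1 + b * δ) / r ^ 2 - 1 ≤ (4 * b + 16 * (C₀ / l)) * δ := by
    rw [sub_le_iff_le_add, div_le_iff₀ (by positivity)]
    have hX : 0 ≤ (4 * b + 16 * (C₀ / l)) * δ := by positivity
    have hrr : 1 / 4 ≤ r ^ 2 := by nlinarith
    nlinarith [mul_le_mul_of_nonneg_left hrr hX]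
  have hmap : ∀ x ∈ Set.Icc 0 l, r * x + a₀ ∈ Set.Icc 0 l := fun x hx =>
    ⟨by have := mul_nonneg hr0.le hx.1; linarith [ha₀.1],
      by have := mul_le_mul_of_nonneg_left hx.2 hr0.le; linarith [ha₁.1]⟩
  have hmain := abs_lambdaDir_sub_le n (k := k) (c := 1 + b * δ) (l := l) (r := r) (a₀ := a₀)
    (a₁ := a₁) (Q := M ^ 2 / 4) (E := K * C₀ * M / 2 * δ) hr0 ht1 (by positivity) (by positivity)
    hk.continuousOn ha₀.1 ha₁.1 hrl
    (fun x hx => by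
      have := sq_le_sq' (neg_le_of_abs_le (hM x hx)) (le_of_abs_le (hM x hx))
      linarith)
    (fun x hx => by
      have h₁ := hk.dist_le_mul x hx _ (hmap x hx)
      rw [Real.dist_eq, Real.dist_eq] at h₁
      have h₂ : |x - (r * x + a₀)| ≤ C₀ * δ := by
        have h₃ : 0 ≤ (1 - r) * x := mul_nonneg (by linarith) hx.1
        have h₄ : (1 - r) * x ≤ (1 - r) * l := mul_le_mul_of_nonneg_left hx.2 (by linarith)
        rw [abs_le]
        constructor <;> linarith [ha₀.2, ha₁.2]
      have h₅ : |k x + k (r * x + a₀)| ≤ 2 * M :=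
        (abs_add_le _ _).trans (by linarith [hM x hx, hM _ (hmap x hx)])
      calc |k x ^ 2 / 4 - k (r * x + a₀) ^ 2 / 4|
          = |k x - k (r * x + a₀)| * |k x + k (r * x + a₀)| / 4 := by
            rw [← abs_mul, ← abs_of_pos (show (0 : ℝ) < 4 by norm_num), ← abs_div,
              abs_of_pos (show (0 : ℝ) < 4 by norm_num)]
            ring_nf
        _ ≤ (K * (C₀ * δ)) * (2 * M) / 4 := by
            gcongr
            exact h₁.trans (by gcongr)
        _ = K * C₀ * M / 2 * δ := by ring)
  set t := (1 + b * δ) / r ^ 2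
  have hsplit : lambdaDir n l k a₀ a₁ (1 + b * δ) - L =
      (lambdaDir n l k a₀ a₁ (1 + b * δ) - t * L) + (t - 1) * L := by ring
  have hL : |(t - 1) * L| = (t - 1) * |L| := by
    rw [abs_mul, abs_of_nonneg (by linarith)]
  calc |lambdaDir n l k a₀ a₁ (1 + b * δ) - L|
      ≤ ((t - 1) * (M ^ 2 / 4) + K * C₀ * M / 2 * δ) + (t - 1) * |L| := by
        rw [hsplit, ← hL]
        exact (abs_add_le _ _).trans (by gcongr)
    _ = (t - 1) * (|L| + M ^ 2 / 4) + K * C₀ * M / 2 * δ := by ring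
    _ ≤ ((4 * b + 16 * (C₀ / l)) * δ) * (|L| + M ^ 2 / 4) + K * C₀ * M / 2 * δ := by gcongr
    _ ≤ ((4 * b + 16 * (C₀ / l)) * (|L| + M ^ 2 / 4) + K * C₀ * M / 2 + 1) * δ := by
        linarith
end

section
/- Let n ≥ 1, let f : ℝⁿ → ℝ and ψ : ℝⁿ → ℂ be differentiable. Then at every point x ∈ ℝⁿ the identity ‖∇(e^{f}ψ)(x)‖² = ‖∇f(x)‖² · e^{2f(x)} · |ψ(x)|² + Re⟨∇(e^{2f}ψ)(x), ∇ψ(x)⟩ holds, where e^{f}ψ denotes the function x ↦ e^{f(x)}ψ(x) and e^{2f}ψ the function x ↦ e^{2f(x)}ψ(x). -/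
/-- The gradient of a complex-valued function on `ℝⁿ`: the vector of its partial
derivatives. -/
noncomputable def cgrad {n : ℕ} (g : EuclideanSpace ℝ (Fin n) → ℂ)
    (x : EuclideanSpace ℝ (Fin n)) : Fin n → ℂ :=
  fun i => fderiv ℝ g x (EuclideanSpace.single i 1)

/-- The gradient of a real-valued function on `ℝⁿ`: the vector of its partial
derivatives. -/
noncomputable def rgrad {n : ℕ} (g : EuclideanSpace ℝ (Fin n) → ℝ)
    (x : EuclideanSpace ℝ (Fin n)) : Fin n → ℝ :=
  fun i => fderiv ℝ g x (EuclideanSpace.single i 1)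

/-- The standard Hermitian inner product `⟨a, b⟩ = ∑ i, conj (a i) * b i` on `ℂⁿ`. -/
noncomputable def hinner {n : ℕ} (a b : Fin n → ℂ) : ℂ :=
  ∑ i, (starRingEnd ℂ) (a i) * b i

/-- Product rule for the gradient of `e^g ψ`. -/
theorem cgrad_exp_mul {n : ℕ} {g : EuclideanSpace ℝ (Fin n) → ℝ}
    {ψ : EuclideanSpace ℝ (Fin n) → ℂ} {x : EuclideanSpace ℝ (Fin n)}
    (hg : DifferentiableAt ℝ g x) (hψ : DifferentiableAt ℝ ψ x) (i : Fin n) :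
    cgrad (fun y => (Real.exp (g y) : ℂ) * ψ y) x i
      = (Real.exp (g x) : ℂ) * ((rgrad g x i : ℂ) * ψ x + cgrad ψ x i) := by
  have hE : HasFDerivAt (fun y => (Real.exp (g y) : ℂ))
      (Complex.ofRealCLM.comp (Real.exp (g x) • fderiv ℝ g x)) x :=
    Complex.ofRealCLM.hasFDerivAt.comp x hg.hasFDerivAt.exp
  unfold cgrad rgrad
  rw [(hE.fun_mul hψ.hasFDerivAt).fderiv]
  simp only [add_apply, smul_apply,
    ContinuousLinearMap.comp_apply, Complex.ofRealCLM_apply, smul_eq_mul, Complex.ofReal_mul]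
  ring

theorem rgrad_const_mul {n : ℕ} {g : EuclideanSpace ℝ (Fin n) → ℝ}
    {x : EuclideanSpace ℝ (Fin n)} (hg : DifferentiableAt ℝ g x) (c : ℝ) (i : Fin n) :
    rgrad (fun y => c * g y) x i = c * rgrad g x i := by
  unfold rgrad
  rw [fderiv_const_mul hg, smul_apply, smul_eq_mul]

/-- Pointwise identity underlying Agmon-type estimates: for differentiable `f : ℝⁿ → ℝ`
and `ψ : ℝⁿ → ℂ`,
`‖∇(e^f ψ)(x)‖² = ‖∇f(x)‖² e^{2f(x)} |ψ(x)|² + Re⟨∇(e^{2f}ψ)(x), ∇ψ(x)⟩`. -/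
theorem stmt18 (n : ℕ) (hn : 1 ≤ n)
    (f : EuclideanSpace ℝ (Fin n) → ℝ) (ψ : EuclideanSpace ℝ (Fin n) → ℂ)
    (hf : Differentiable ℝ f) (hψ : Differentiable ℝ ψ)
    (x : EuclideanSpace ℝ (Fin n)) :
    (∑ i, ‖cgrad (fun y => (Real.exp (f y) : ℂ) * ψ y) x i‖ ^ 2)
      = (∑ i, rgrad f x i ^ 2) * Real.exp (2 * f x) * ‖ψ x‖ ^ 2
        + (hinner (cgrad (fun y => (Real.exp (2 * f y) : ℂ) * ψ y) x) (cgrad ψ x)).re := by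
  rw [hinner, Complex.re_sum, Finset.sum_mul, Finset.sum_mul, ← Finset.sum_add_distrib]
  refine Finset.sum_congr rfl fun i _ => ?_
  rw [cgrad_exp_mul (hf x) (hψ x), cgrad_exp_mul ((hf x).const_mul 2) (hψ x),
    rgrad_const_mul (hf x), two_mul (f x), Real.exp_add]
  simp only [Complex.sq_norm, Complex.normSq_apply, Complex.mul_re, Complex.mul_im,
    Complex.add_re, Complex.add_im, Complex.conj_re, Complex.conj_im, Complex.ofReal_re,
    Complex.ofReal_im]
  ring
end
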